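/- DRAO-S linear rate for smooth strongly convex problems (Theorem 4.2): in the smooth setting with u α-strongly convex (α > 0) and κ := L_f/α, run DRAO-S with θ_t = θ := (√(8κ+1) − 1)/(√(8κ+1) + 1), w_t = (1/θ)^{t−1}, τ_t = τ := (√(8κ+1) − 1)/2, η_t = η := α(√(8κ+1) − 1)/4, β_s^t = α(s−1)/4, γ_s^t = 2S_t(S_t+1)/(w_tαsΔ), δ_s^t = (s−1)/s, q_s^t = s, S_t = ⌈(2w_tΔ)^{1/2}M_t⌉, for any Δ > 0, where M_t := ‖v^t‖_{2,U*} and D_P := max_{p,p̄∈P}√(2U(p,p̄)). Then the last iterate satisfies ‖x^N − x*‖² ≤ θ^N ((1 + 2κ)‖x⁰ − x*‖² + 4D_P²/(αηΔ)) for all N ≥ 1, and there exists M̃ with M_t ≤ M̃ for all t ≥ 1. -/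

import Mathlib

open RealInnerProductSpace

lemma aux_limit {A B : ℝ} (h : ∀ l : ℝ, 0 < l → l < 1 → A ≤ B * l) : A ≤ 0 := by
  have h1 : Filter.Tendsto (fun l : ℝ => B * l) (nhdsWithin 0 (Set.Ioi 0)) (nhds 0) := by
    have : Filter.Tendsto (fun l : ℝ => B * l) (nhds 0) (nhds (B * 0)) :=
      (continuous_const.mul continuous_id).tendsto 0
    rw [mul_zero] at this
    exact this.mono_left nhdsWithin_le_nhds
  refine ge_of_tendsto h1 ?_
  have : Set.Ioo (0:ℝ) 1 ∈ nhdsWithin (0:ℝ) (Set.Ioi 0) := Ioo_mem_nhdsGT one_pos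
  filter_upwards [this] with l hl using h l hl.1 hl.2

section
variable {E : Type*} [NormedAddCommGroup E] [InnerProductSpace ℝ E]

lemma aux_norm_comb (y x c : E) (l : ℝ) :
    ‖(1 - l) • y + l • x - c‖ ^ 2 = (1 - l) * ‖y - c‖ ^ 2 + l * ‖x - c‖ ^ 2
      - l * (1 - l) * ‖x - y‖ ^ 2 := by
  have e1 : (1 - l) • y + l • x - c = (1 - l) • (y - c) + l • (x - c) := by module
  have e2 : x - y = (x - c) - (y - c) := by module
  rw [e1, e2]
  rw [norm_add_sq_real, norm_sub_sq_real (x - c) (y - c), norm_smul, norm_smul, inner_smul_left, inner_smul_right,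
    mul_pow, mul_pow, real_inner_comm (x - c) (y - c)]
  simp only [Real.norm_eq_abs, sq_abs, conj_trivial]
  ring

lemma aux_yprox {X : Set E} (hX : Convex ℝ X) {α b η : ℝ} {u : E → ℝ}
    (hu : StrongConvexOn Set.univ α u) (vt a c y x : E) (hy : y ∈ X) (hx : x ∈ X)
    (hmin : IsMinOn (fun yy => ⟪yy, vt⟫ + u yy + b / 2 * ‖yy - a‖ ^ 2
      + η / 2 * ‖yy - c‖ ^ 2) X y) :
    ⟪y - x, vt⟫ + u y - u x + η / 2 * (‖y - c‖ ^ 2 - ‖x - c‖ ^ 2)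
      + b / 2 * (‖y - a‖ ^ 2 - ‖x - a‖ ^ 2) + (α + b + η) / 2 * ‖x - y‖ ^ 2 ≤ 0 := by
  apply aux_limit (B := (α + b + η) / 2 * ‖x - y‖ ^ 2)
  intro l hl0 hl1
  have hmem : (1 - l) • y + l • x ∈ X := hX hy hx (by linarith) hl0.le (by ring)
  have h1 := hmin hmem
  simp only [Set.mem_ofPred_eq] at h1
  rw [aux_norm_comb, aux_norm_comb, inner_add_left, inner_smul_left, inner_smul_left] at h1
  simp only [conj_trivial] at h1
  have h2 := hu.2 (Set.mem_univ y) (Set.mem_univ x) (by linarith : 0 ≤ 1 - l) hl0.le (by ring)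
  simp only [smul_eq_mul] at h2
  rw [norm_sub_rev y x] at h2
  rw [inner_sub_left]
  have h3 : l * (⟪y, vt⟫ - ⟪x, vt⟫ + u y - u x + η / 2 * (‖y - c‖ ^ 2 - ‖x - c‖ ^ 2)
      + b / 2 * (‖y - a‖ ^ 2 - ‖x - a‖ ^ 2) + (α + b + η) / 2 * ‖x - y‖ ^ 2) ≤
      l * ((α + b + η) / 2 * ‖x - y‖ ^ 2 * l) := by
    nlinarith [h1, h2]
  exact le_of_mul_le_mul_left h3 hl0

end

lemma aux_pprox {m : ℕ} {P : Set (Fin m → ℝ)} (hP : Convex ℝ P) {ρ : (Fin m → ℝ) → ℝ}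
    (hρ : ConvexOn ℝ Set.univ ρ) {ω : (Fin m → ℝ) → ℝ} (hω : Differentiable ℝ ω)
    {U : (Fin m → ℝ) → (Fin m → ℝ) → ℝ}
    (hU : ∀ p p', U p p' = ω p - ω p' - (fderiv ℝ ω p') (p - p'))
    (c : Fin m → ℝ) (γ : ℝ) (p0 ps p : Fin m → ℝ) (hps : ps ∈ P) (hp : p ∈ P)
    (hmax : IsMaxOn (fun p' => (∑ i, p' i * c i) - ρ p' - γ * U p' p0) P ps) :
    (∑ i, p i * c i) - ρ p - ((∑ i, ps i * c i) - ρ ps)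
      + γ * (U ps p0 + U p ps - U p p0) ≤ 0 := by
  have hd : HasDerivAt (fun l : ℝ => ω (ps + l • (p - ps))) (fderiv ℝ ω ps (p - ps)) 0 := by
    have h1 : HasDerivAt (fun l : ℝ => ps + l • (p - ps)) (p - ps) 0 := by
      simpa using ((hasDerivAt_id (0:ℝ)).smul_const (p - ps)).const_add ps
    have h2 : HasFDerivAt ω (fderiv ℝ ω ps) (ps + (0:ℝ) • (p - ps)) := by
      simpa using (hω ps).hasFDerivAt
    exact h2.comp_hasDerivAt (0:ℝ) h1
  have ht := hd.tendsto_slope_zero_right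
  simp only [zero_add, zero_smul, add_zero, smul_eq_mul] at ht
  have ht2 := (ht.sub_const (fderiv ℝ ω p0 (p - ps))).const_mul γ
  have key : (∑ i, p i * c i) - ρ p - ((∑ i, ps i * c i) - ρ ps) ≤
      γ * (fderiv ℝ ω ps (p - ps) - fderiv ℝ ω p0 (p - ps)) := by
    refine ge_of_tendsto ht2 ?_
    have : Set.Ioo (0:ℝ) 1 ∈ nhdsWithin (0:ℝ) (Set.Ioi 0) := Ioo_mem_nhdsGT one_pos
    filter_upwards [this] with l hl
    obtain ⟨hl0, hl1⟩ := hl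
    have e : (1 - l) • ps + l • p = ps + l • (p - ps) := by module
    have hmem : ps + l • (p - ps) ∈ P := by
      rw [← e]; exact hP hps hp (by linarith) hl0.le (by ring)
    have h1 := hmax hmem
    simp only [Set.mem_ofPred_eq] at h1
    have h2 := hρ.2 (Set.mem_univ ps) (Set.mem_univ p) (by linarith : 0 ≤ 1 - l) hl0.le (by ring)
    rw [e] at h2
    simp only [smul_eq_mul] at h2
    have h3 : ∑ i, (ps + l • (p - ps)) i * c i = (1 - l) * (∑ i, ps i * c i)
        + l * ∑ i, p i * c i := by
      rw [Finset.mul_sum, Finset.mul_sum, ← Finset.sum_add_distrib]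
      refine Finset.sum_congr rfl fun i _ => ?_
      simp only [Pi.add_apply, Pi.smul_apply, Pi.sub_apply, smul_eq_mul]; ring
    have h4 : U (ps + l • (p - ps)) p0 - U ps p0 = ω (ps + l • (p - ps)) - ω ps
        - l * fderiv ℝ ω p0 (p - ps) := by
      rw [hU, hU, show ps + l • (p - ps) - p0 = (ps - p0) + l • (p - ps) by module, map_add,
        map_smul, smul_eq_mul]; ring
    have h5 : l * ((∑ i, p i * c i) - ρ p - ((∑ i, ps i * c i) - ρ ps)) ≤
        γ * (ω (ps + l • (p - ps)) - ω ps - l * fderiv ℝ ω p0 (p - ps)) := by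
      rw [← h4]; rw [h3] at h1; linarith
    have h6 : l * (γ * (l⁻¹ * (ω (ps + l • (p - ps)) - ω ps) - fderiv ℝ ω p0 (p - ps))) =
      γ * (ω (ps + l • (p - ps)) - ω ps - l * fderiv ℝ ω p0 (p - ps)) := by
      field_simp
    rw [← h6] at h5
    exact le_of_mul_le_mul_left h5 hl0
  have e2 : U ps p0 + U p ps - U p p0 =
      - (fderiv ℝ ω ps (p - ps) - fderiv ℝ ω p0 (p - ps)) := by
    rw [hU, hU, hU, show p - p0 = (p - ps) + (ps - p0) by abel, map_add]; ring
  rw [e2]; linarith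

section
variable {E : Type*} [NormedAddCommGroup E] [InnerProductSpace ℝ E] [CompleteSpace E]

lemma aux_line {g : E → ℝ} {G : E → E} (hg : ∀ x, HasGradientAt g (G x) x) (a d : E) (s : ℝ) :
    HasDerivAt (fun s : ℝ => g (a + s • d)) ⟪G (a + s • d), d⟫ s := by
  have h1 : HasDerivAt (fun l : ℝ => a + l • d) d s := by
    simpa using ((hasDerivAt_id s).smul_const d).const_add a
  have h2 := (hg (a + s • d)).hasFDerivAt
  have h3 := h2.comp_hasDerivAt s h1
  rw [InnerProductSpace.toDual_apply_apply] at h3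
  exact h3

lemma aux_descent {g : E → ℝ} {G : E → E} (hg : ∀ x, HasGradientAt g (G x) x) {L : ℝ}
    (hL : ∀ x y, ‖G x - G y‖ ≤ L * ‖x - y‖) (a b : E) :
    g b ≤ g a + ⟪G a, b - a⟫ + L / 2 * ‖b - a‖ ^ 2 := by
  set d := b - a with hd
  have hder : ∀ s : ℝ, HasDerivAt (fun s : ℝ => s * ⟪G a, d⟫ + L / 2 * ‖d‖ ^ 2 * s ^ 2
      - g (a + s • d)) (⟪G a, d⟫ + L * ‖d‖ ^ 2 * s - ⟪G (a + s • d), d⟫) s := by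
    intro s
    have h1 := ((hasDerivAt_id s).mul_const ⟪G a, d⟫)
    have h2 := ((hasDerivAt_id s).pow 2).const_mul (L / 2 * ‖d‖ ^ 2)
    have := (h1.add h2).sub (aux_line hg a d s)
    refine this.congr_deriv ?_
    simp only [id_eq, one_mul, Nat.cast_ofNat, mul_one]
    ring
  have hmono : MonotoneOn (fun s : ℝ => s * ⟪G a, d⟫ + L / 2 * ‖d‖ ^ 2 * s ^ 2
      - g (a + s • d)) (Set.Icc 0 1) := by
    refine monotoneOn_of_deriv_nonneg (convex_Icc 0 1) ?_ ?_ ?_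
    · exact fun s _ => (hder s).continuousAt.continuousWithinAt
    · exact fun s _ => (hder s).differentiableAt.differentiableWithinAt
    · intro s hs
      rw [(hder s).deriv]
      rw [interior_Icc] at hs
      have h1 : ⟪G (a + s • d) - G a, d⟫ ≤ L * ‖d‖ ^ 2 * s := by
        calc ⟪G (a + s • d) - G a, d⟫ ≤ ‖G (a + s • d) - G a‖ * ‖d‖ := real_inner_le_norm _ _
          _ ≤ (L * ‖a + s • d - a‖) * ‖d‖ := by gcongr; exact hL _ _
          _ = L * ‖d‖ ^ 2 * s := by
            rw [add_sub_cancel_left, norm_smul, Real.norm_eq_abs, abs_of_pos hs.1]; ring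
      rw [inner_sub_left] at h1
      linarith
  have := hmono (Set.left_mem_Icc.2 zero_le_one) (Set.right_mem_Icc.2 zero_le_one) zero_le_one
  simp only [zero_mul, zero_smul, add_zero, one_mul, one_smul] at this
  have e : a + d = b := by rw [hd]; abel
  rw [e] at this
  linarith

lemma aux_convex_lower {g : E → ℝ} {G : E → E} (hg : ∀ x, HasGradientAt g (G x) x)
    (hc : ConvexOn ℝ Set.univ g) (a b : E) : g a + ⟪G a, b - a⟫ ≤ g b := by
  have hd := aux_line hg a (b - a) 0
  have ht := hd.tendsto_slope_zero_right
  simp only [zero_add, zero_smul, add_zero, smul_eq_mul] at ht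
  have key : ⟪G a, b - a⟫ ≤ g b - g a := by
    refine le_of_tendsto ht ?_
    have : Set.Ioo (0:ℝ) 1 ∈ nhdsWithin (0:ℝ) (Set.Ioi 0) := Ioo_mem_nhdsGT one_pos
    filter_upwards [this] with l hl
    obtain ⟨hl0, hl1⟩ := hl
    have h2 := hc.2 (Set.mem_univ a) (Set.mem_univ b) (by linarith : 0 ≤ 1 - l) hl0.le (by ring)
    rw [show (1 - l) • a + l • b = a + l • (b - a) by module] at h2
    simp only [smul_eq_mul] at h2
    rw [inv_mul_le_iff₀ hl0]; linarith
  linarith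

lemma aux_cocoercive {g : E → ℝ} {G : E → E} (hg : ∀ x, HasGradientAt g (G x) x)
    (hc : ConvexOn ℝ Set.univ g) {L : ℝ} (hL0 : 0 < L)
    (hL : ∀ x y, ‖G x - G y‖ ≤ L * ‖x - y‖) (a b : E) :
    1 / (2 * L) * ‖G b - G a‖ ^ 2 ≤ g b - (g a + ⟪G a, b - a⟫) := by
  set d := G b - G a with hd
  have h1 := aux_convex_lower hg hc a (b - L⁻¹ • d)
  have h2 := aux_descent hg hL b (b - L⁻¹ • d)
  rw [show b - L⁻¹ • d - b = - (L⁻¹ • d) by abel, inner_neg_right, inner_smul_right, norm_neg,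
    norm_smul, mul_pow, Real.norm_eq_abs, sq_abs] at h2
  rw [show b - L⁻¹ • d - a = (b - a) - L⁻¹ • d by abel, inner_sub_right, inner_smul_right] at h1
  have h3 : ⟪G b, d⟫ - ⟪G a, d⟫ = ‖d‖ ^ 2 := by
    rw [← inner_sub_left, ← hd, real_inner_self_eq_norm_sq]
  have h4 : ⟪G b, d⟫ = ‖d‖ ^ 2 + ⟪G a, d⟫ := by linarith
  rw [h4] at h2
  have h5 : L / 2 * (L⁻¹ ^ 2 * ‖d‖ ^ 2) = 1 / (2 * L) * ‖d‖ ^ 2 := by field_simp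
  have h6 : L⁻¹ * ‖d‖ ^ 2 = 2 * (1 / (2 * L) * ‖d‖ ^ 2) := by field_simp
  rw [h5, mul_add, h6] at h2
  linarith

end

lemma aux_amgm {c A B n d : ℝ} (hA : 0 ≤ A) (hB : 0 ≤ B) (h : c ^ 2 ≤ 4 * A * B) :
    c * n * d ≤ A * n ^ 2 + B * d ^ 2 := by
  have h0 : 0 ≤ A * n ^ 2 + B * d ^ 2 := by positivity
  have h1 : (c * n * d) ^ 2 ≤ (A * n ^ 2 + B * d ^ 2) ^ 2 := by
    have : c ^ 2 * (n * d) ^ 2 ≤ 4 * A * B * (n * d) ^ 2 := by gcongr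
    nlinarith [sq_nonneg (A * n ^ 2 - B * d ^ 2)]
  exact (abs_le.1 (abs_le_of_sq_le_sq h1 h0)).2

section
variable {E : Type*} [NormedAddCommGroup E] [InnerProductSpace ℝ E]

lemma aux_convex_sq (c : E) {k : ℝ} (hk : 0 ≤ k) :
    ConvexOn ℝ Set.univ (fun z : E => k * ‖z - c‖ ^ 2) := by
  refine ⟨convex_univ, fun y _ x _ a b ha hb hab => ?_⟩
  obtain rfl : a = 1 - b := by linarith
  simp only [smul_eq_mul]
  rw [aux_norm_comb]
  have : 0 ≤ k * (b * (1 - b) * ‖x - y‖ ^ 2) := by positivity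
  nlinarith

lemma aux_convex_aff {m : ℕ} (p fx : Fin m → ℝ) (v : Fin m → E) (xu : E) :
    ConvexOn ℝ Set.univ (fun z : E => ∑ i, p i * (fx i + ⟪v i, z - xu⟫)) := by
  refine ⟨convex_univ, fun y _ x _ a b ha hb hab => ?_⟩
  obtain rfl : a = 1 - b := by linarith
  simp only [smul_eq_mul, inner_sub_right, inner_add_right, inner_smul_right]
  rw [Finset.mul_sum, Finset.mul_sum, ← Finset.sum_add_distrib]
  exact le_of_eq (Finset.sum_congr rfl fun i _ => by ring)

set_option maxHeartbeats 4000000 in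
lemma aux_inner {m : ℕ} {X : Set E} (hXcv : Convex ℝ X) {P : Set (Fin m → ℝ)}
    (hPcv : Convex ℝ P) {α : ℝ} (hα : 0 < α) {u : E → ℝ}
    (hu : StrongConvexOn Set.univ α u) {ρ : (Fin m → ℝ) → ℝ} (hρ : ConvexOn ℝ Set.univ ρ)
    {ω : (Fin m → ℝ) → ℝ} (hω : Differentiable ℝ ω)
    {U : (Fin m → ℝ) → (Fin m → ℝ) → ℝ}
    (hU : ∀ p p', U p p' = ω p - ω p' - (fderiv ℝ ω p') (p - p'))
    {NU : (Fin m → ℝ) → ℝ} (hNU0 : NU 0 = 0)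
    (hUs : ∀ p p', (1 / 2) * (NU (p - p')) ^ 2 ≤ U p p')
    (fx : Fin m → ℝ) (v : Fin m → E) (xu c : E) {η : ℝ} (hη : 0 ≤ η)
    {M : ℝ} (hM : ∀ p z, ∑ i, p i * ⟪v i, z⟫ ≤ M * NU p * ‖z‖)
    {S : ℕ} (hS : 1 ≤ S) {w Δ : ℝ} (hw : 0 < w) (hΔ : 0 < Δ)
    (hSM : 2 * w * Δ * M ^ 2 ≤ (S : ℝ) ^ 2)
    (y : ℕ → E) (pq : ℕ → Fin m → ℝ) (vtil : ℕ → E)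
    (hvtil : ∀ k : ℕ, vtil (k + 1) = (∑ i, pq k i • v i)
      + ((k : ℝ) / ((k : ℝ) + 1)) • ∑ i, (pq k i - pq (k - 1) i) • v i)
    (hy : ∀ s : ℕ, 1 ≤ s → s ≤ S → y s ∈ X ∧
      IsMinOn (fun yy => ⟪yy, vtil s⟫ + u yy
        + (α * ((s : ℝ) - 1) / 4) / 2 * ‖yy - y (s-1)‖ ^ 2
        + η / 2 * ‖yy - c‖ ^ 2) X (y s))
    (hpq : ∀ s : ℕ, 1 ≤ s → s ≤ S → pq s ∈ P ∧
      IsMaxOn (fun p' =>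
        (∑ i, p' i * (fx i + ⟪v i, y s - xu⟫)) - ρ p'
        - (2 * (S : ℝ) * ((S : ℝ) + 1) / (w * α * (s : ℝ) * Δ)) * U p' (pq (s-1))) P (pq s))
    {xx : E} (hxx : xx ∈ X) {p : Fin m → ℝ} (hp : p ∈ P) {B : ℝ}
    (hB : ∀ p' ∈ P, (∑ i, p' i * (fx i + ⟪v i, xx - xu⟫)) - ρ p' + u xx ≤ B)
    {xt : E} (hxt : xt = (∑ s ∈ Finset.Icc 1 S, (s : ℝ))⁻¹ •
        ∑ s ∈ Finset.Icc 1 S, (s : ℝ) • y s) :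
    (∑ i, p i * (fx i + ⟪v i, xt - xu⟫)) - ρ p + u xt - B + η / 2 * ‖xt - c‖ ^ 2
      - η / 2 * ‖xx - c‖ ^ 2 + (η + α / 2) / 2 * ‖xt - xx‖ ^ 2
      ≤ 4 / (w * α * Δ) * (U p (pq 0) - U p (pq S)) := by
  have hSr : (1:ℝ) ≤ S := by exact_mod_cast hS
  have hS0 : (0:ℝ) < S := by linarith
  set G : ℝ := 2 * (S : ℝ) * ((S : ℝ) + 1) / (w * α * Δ) with hG
  have hGpos : 0 < G := by positivity
  have hGα : G * α = 2 * (S : ℝ) * ((S : ℝ) + 1) / (w * Δ) := by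
    rw [hG]; field_simp
  have hM2 : M ^ 2 ≤ (S:ℝ) ^ 2 / (2 * (w * Δ)) := by
    rw [le_div_iff₀ (by positivity)]; nlinarith
  have hM3 : 4 * M ^ 2 ≤ G * α := by
    rw [hGα]
    have : (S:ℝ) ^ 2 / (2 * (w * Δ)) * 4 ≤ 2 * (S : ℝ) * ((S : ℝ) + 1) / (w * Δ) := by
      rw [div_mul_eq_mul_div, div_le_div_iff₀ (by positivity) (by positivity)]
      have : 0 < w * Δ := by positivity
      nlinarith [mul_pos hS0 this]
    linarith
  set Θ : E → ℝ := fun z => (∑ i, p i * (fx i + ⟪v i, z - xu⟫)) + u z + η / 2 * ‖z - c‖ ^ 2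
    + (η + α / 2) / 2 * ‖z - xx‖ ^ 2 with hΘ
  have hΘc : ConvexOn ℝ Set.univ Θ := by
    have huc : ConvexOn ℝ Set.univ u :=
      UniformConvexOn.convexOn hu (fun r => by
        have : 0 ≤ α / 2 * r ^ 2 := by positivity
        simpa using this)
    exact (((aux_convex_aff p fx v xu).add huc).add (aux_convex_sq c (by positivity))).add
      (aux_convex_sq xx (by positivity))
  set C : ℝ := B + ρ p + η / 2 * ‖xx - c‖ ^ 2 with hC
  have hin : ∀ (q : Fin m → ℝ) (z : E), ⟪z, ∑ i, q i • v i⟫ = ∑ i, q i * ⟪v i, z⟫ := by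
    intro q z
    rw [inner_sum]
    exact Finset.sum_congr rfl fun i _ => by rw [inner_smul_right, real_inner_comm]
  set A : ℕ → E → ℝ := fun k z => ∑ i, (pq k i - pq (k - 1) i) * ⟪v i, z⟫ with hA
  set N : ℕ → ℝ := fun k => NU (pq k - pq (k - 1)) with hN
  have hAle : ∀ k z, A k z ≤ M * N k * ‖z‖ := fun k z => hM (pq k - pq (k - 1)) z
  have hAsub : ∀ k z z', A k (z - z') = A k z - A k z' := by
    intro k z z'
    simp only [hA, inner_sub_right, mul_sub, Finset.sum_sub_distrib]
  have claim : ∀ k : ℕ, k ≤ S →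
      (∑ s ∈ Finset.Icc 1 k, (s : ℝ) * (Θ (y s) - C)) + G * (U p (pq k) - U p (pq 0))
        + G / 2 * N k ^ 2 - k * A k (y k - xx)
        + α * k * (k + 1) / 8 * ‖xx - y k‖ ^ 2 ≤ 0 := by
    intro k
    induction k with
    | zero => intro _; simp [hN, hNU0]
    | succ k ih =>
      intro hk
      have ih := ih (by omega)
      rw [Finset.sum_Icc_succ_top (by omega)]
      obtain ⟨hyX, hymin⟩ := hy (k + 1) (by omega) hk
      obtain ⟨hpP, hpmax⟩ := hpq (k + 1) (by omega) hk
      have h1 := aux_yprox hXcv hu _ _ _ _ xx hyX hxx hymin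
      have h2 := aux_pprox hPcv hρ hω hU _ _ _ _ p hpP hp hpmax
      have h3 := hB _ hpP
      simp only [Nat.add_sub_cancel] at h1 h2
      push_cast at h1 h2 ⊢
      set s : ℝ := (k : ℝ) + 1 with hs
      have hk0 : (0:ℝ) ≤ k := Nat.cast_nonneg k
      have hs0 : 0 < s := by positivity
      have e1 : s * ⟪y (k + 1) - xx, vtil (k + 1)⟫ =
          s * ∑ i, pq (k + 1) i * ⟪v i, y (k + 1) - xx⟫ - s * A (k + 1) (y (k + 1) - xx)
          + k * A k (y (k + 1) - xx) := by
        rw [hvtil, inner_add_right, inner_smul_right, hin, hin (fun i => pq k i - pq (k-1) i)]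
        simp only [hA, Nat.add_sub_cancel, sub_mul, Finset.sum_sub_distrib]
        field_simp
        ring
      have e2 : ∑ i, pq (k + 1) i * (fx i + ⟪v i, y (k + 1) - xu⟫) =
          ∑ i, pq (k + 1) i * (fx i + ⟪v i, xx - xu⟫)
          + ∑ i, pq (k + 1) i * ⟪v i, y (k + 1) - xx⟫ := by
        rw [← Finset.sum_add_distrib]
        refine Finset.sum_congr rfl fun i _ => ?_
        simp only [inner_sub_right]; ring
      have e3 : s * (2 * (S : ℝ) * ((S : ℝ) + 1) / (w * α * s * Δ)) = G := by
        rw [hG]; field_simp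
      have e4 : k * A k (y (k + 1) - xx) = k * A k (y k - xx) - k * A k (y k - y (k + 1)) := by
        simp only [hAsub]; ring
      have h4 : k * A k (y k - y (k + 1)) ≤
          G / 2 * N k ^ 2 + α * k * s / 8 * ‖y (k + 1) - y k‖ ^ 2 := by
        have := aux_amgm (c := k * M) (A := G / 2) (B := α * k * s / 8) (n := N k)
          (d := ‖y (k + 1) - y k‖) (by positivity) (by positivity) (by
            have hh : 4 * M ^ 2 * (k * s) ≤ G * α * (k * s) := by gcongr
            have hh2 : M ^ 2 * (k * k) ≤ M ^ 2 * (k * s) := by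
              have : (k:ℝ) ≤ s := by rw [hs]; linarith
              gcongr
            nlinarith)
        have h5 := hAle k (y k - y (k + 1))
        rw [norm_sub_rev] at h5
        have h6 := mul_le_mul_of_nonneg_left h5 hk0
        linarith
      have h5 := hUs (pq (k + 1)) (pq k)
      have h6 : G * (1 / 2 * N (k + 1) ^ 2) ≤ G * U (pq (k + 1)) (pq k) :=
        mul_le_mul_of_nonneg_left h5 hGpos.le
      have h1' := mul_le_mul_of_nonneg_left h1 hs0.le
      have h2' := mul_le_mul_of_nonneg_left h2 hs0.le
      have h3' := mul_le_mul_of_nonneg_left h3 hs0.le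
      have e5 : s * ((2 * (S : ℝ) * ((S : ℝ) + 1) / (w * α * s * Δ)) *
          (U (pq (k + 1)) (pq k) + U p (pq (k + 1)) - U p (pq k))) =
          G * (U (pq (k + 1)) (pq k) + U p (pq (k + 1)) - U p (pq k)) := by
        rw [← mul_assoc, e3]
      have e6 : ‖xx - y (k + 1)‖ = ‖y (k + 1) - xx‖ := norm_sub_rev _ _
      have e7 : s - 1 = k := by rw [hs]; ring
      rw [e2] at h2'
      rw [mul_add, e5] at h2'
      rw [e7] at h1'
      rw [e6] at h1' ⊢
      simp only [hΘ, hC]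
      have e8 : s * (⟪y (k + 1) - xx, vtil (k + 1)⟫ + u (y (k + 1)) - u xx
          + η / 2 * (‖y (k + 1) - c‖ ^ 2 - ‖xx - c‖ ^ 2)
          + (α * k / 4) / 2 * (‖y (k + 1) - y k‖ ^ 2 - ‖xx - y k‖ ^ 2)
          + (α + α * k / 4 + η) / 2 * ‖y (k + 1) - xx‖ ^ 2) =
          s * ⟪y (k + 1) - xx, vtil (k + 1)⟫ + s * (u (y (k + 1)) - u xx
          + η / 2 * (‖y (k + 1) - c‖ ^ 2 - ‖xx - c‖ ^ 2))
          + α * k * s / 8 * (‖y (k + 1) - y k‖ ^ 2 - ‖xx - y k‖ ^ 2)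
          + s * ((η + α / 2) / 2 * ‖y (k + 1) - xx‖ ^ 2)
          + α * s * (s + 1) / 8 * ‖y (k + 1) - xx‖ ^ 2 := by
        rw [hs]; ring
      rw [e8, e1, e4] at h1'
      simp only [hΘ, hC] at ih
      linarith
  have hfin := claim S le_rfl
  have hlast : S * A S (y S - xx) ≤ G / 2 * N S ^ 2 + α * S * (S + 1) / 8 * ‖xx - y S‖ ^ 2 := by
    have := aux_amgm (c := S * M) (A := G / 2) (B := α * S * (S + 1) / 8) (n := N S)
      (d := ‖xx - y S‖) (by positivity) (by positivity) (by
        have hh : 4 * M ^ 2 * (S * (S + 1)) ≤ G * α * (S * ((S:ℝ) + 1)) := by gcongr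
        have hh2 : M ^ 2 * (S * S) ≤ M ^ 2 * (S * ((S:ℝ) + 1)) := by
          have : (S:ℝ) ≤ S + 1 := by linarith
          gcongr
        nlinarith)
    have h5 := hAle S (y S - xx)
    rw [norm_sub_rev] at h5
    have h6 := mul_le_mul_of_nonneg_left h5 hS0.le
    linarith
  have hsum : (∑ s ∈ Finset.Icc 1 S, (s : ℝ)) = S * (S + 1) / 2 := by
    clear * -
    induction S with
    | zero => simp
    | succ k ih => rw [Finset.sum_Icc_succ_top (by omega), ih]; push_cast; ring
  set T : ℝ := ∑ s ∈ Finset.Icc 1 S, (s : ℝ) with hT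
  have hTpos : 0 < T := by rw [hsum]; positivity
  have hJ : T * Θ xt ≤ ∑ s ∈ Finset.Icc 1 S, (s : ℝ) * Θ (y s) := by
    have := hΘc.map_centerMass_le (t := Finset.Icc 1 S) (w := fun s : ℕ => (s:ℝ)) (p := y)
      (fun s _ => Nat.cast_nonneg s) hTpos (fun _ _ => Set.mem_univ _)
    rw [Finset.centerMass, Finset.centerMass, ← hT, ← hxt, smul_eq_mul] at this
    have := mul_le_mul_of_nonneg_left this hTpos.le
    rw [mul_inv_cancel_left₀ hTpos.ne'] at this
    simpa using this
  have hexp : ∑ s ∈ Finset.Icc 1 S, (s : ℝ) * (Θ (y s) - C) =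
      (∑ s ∈ Finset.Icc 1 S, (s : ℝ) * Θ (y s)) - T * C := by
    simp only [mul_sub, Finset.sum_sub_distrib, hT, Finset.sum_mul]
  have hGT : G = T * (4 / (w * α * Δ)) := by
    rw [hsum, hG]; field_simp; ring
  have hmain : T * (Θ xt - C) ≤ T * (4 / (w * α * Δ) * (U p (pq 0) - U p (pq S))) := by
    rw [← mul_assoc, ← hGT, mul_sub]
    rw [hexp] at hfin
    linarith
  have := le_of_mul_le_mul_left hmain hTpos
  simp only [hΘ, hC] at this
  linarith

end

section
variable {E : Type*} [NormedAddCommGroup E] [InnerProductSpace ℝ E] [CompleteSpace E]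

set_option maxHeartbeats 2000000 in
lemma aux_outer {g : E → ℝ} {G : E → E} (hg : ∀ x, HasGradientAt g (G x) x)
    (hc : ConvexOn ℝ Set.univ g) {L : ℝ} (hL0 : 0 < L)
    (hL : ∀ x y, ‖G x - G y‖ ≤ L * ‖x - y‖) {θ τ η K : ℝ}
    (hθ : 0 < θ) (hτ : 0 < τ) (hη : 0 < η) (h1 : θ * (1 + τ) = τ) (h2 : L = η * (1 + τ))
    (x xu : ℕ → E) (xs : E) (hxu0 : xu 0 = x 0)
    (hxu : ∀ k, (1 + τ) • xu (k + 1) = x k + θ • (x k - x (k - 1)) + τ • xu k)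
    (r Up : ℕ → ℝ)
    (hstep : ∀ k, g (xu (k + 1)) + ⟪G (xu (k + 1)), x (k + 1) - xu (k + 1)⟫ + r k
      + η / 2 * ‖x (k + 1) - x k‖ ^ 2 - η / 2 * ‖xs - x k‖ ^ 2
      + (η / θ) / 2 * ‖x (k + 1) - xs‖ ^ 2 ≤ K / (1 / θ) ^ k * (Up k - Up (k + 1))) (N : ℕ) :
    (∑ k ∈ Finset.range N, (1 / θ) ^ k * (g xs + ⟪G xs, x (k + 1) - xs⟫ + r k))
      + (1 / θ) ^ N * (η / 2 * ‖x N - xs‖ ^ 2) + K * Up N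
      ≤ η / 2 * ‖x 0 - xs‖ ^ 2 + τ * (L / 2 * ‖x 0 - xs‖ ^ 2) + K * Up 0 := by
  set D : E → E → ℝ := fun b a => g b - (g a + ⟪G a, b - a⟫) with hD
  have hDco : ∀ b a, 1 / (2 * L) * ‖G b - G a‖ ^ 2 ≤ D b a :=
    fun b a => aux_cocoercive hg hc hL0 hL a b
  have claim : ∀ N : ℕ,
      (∑ k ∈ Finset.range N, (1 / θ) ^ k * (g xs + ⟪G xs, x (k + 1) - xs⟫ + r k))
      + (1 / θ) ^ N * (η / 2 * ‖x N - xs‖ ^ 2) + τ * (1 / θ) ^ N * D (xu N) xs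
      - θ * (1 / θ) ^ N * ⟪G xs - G (xu N), x N - x (N - 1)⟫
      + θ * (1 / θ) ^ N * (η / 2 * ‖x N - x (N - 1)‖ ^ 2) + K * Up N
      ≤ η / 2 * ‖x 0 - xs‖ ^ 2 + τ * D (x 0) xs + K * Up 0 := by
    intro N
    induction N with
    | zero => simp [hxu0]
    | succ N ih =>
      rw [Finset.sum_range_succ]
      simp only [Nat.add_sub_cancel]
      set W : ℝ := (1 / θ) ^ N with hW
      have hWpos : 0 < W := by positivity
      have hW' : (1 / θ) ^ (N + 1) = W / θ := by rw [pow_succ, ← hW]; ring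
      rw [hW']
      have hs := mul_le_mul_of_nonneg_left (hstep N) hWpos.le
      rw [← hW, ← mul_assoc, mul_div_cancel₀ _ hWpos.ne'] at hs
      have hrel : ∀ c : E, (1 + τ) * ⟪c, xu (N + 1)⟫ = ⟪c, x N⟫
          + θ * (⟪c, x N⟫ - ⟪c, x (N - 1)⟫) + τ * ⟪c, xu N⟫ := by
        intro c
        have := congrArg (fun z => ⟪c, z⟫) (hxu N)
        simpa only [inner_add_right, inner_smul_right, inner_sub_right] using this
      have hid : g xs + ⟪G xs, x (N + 1) - xs⟫ =
          g (xu (N + 1)) + ⟪G (xu (N + 1)), x (N + 1) - xu (N + 1)⟫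
          + τ * D (xu N) xs - (1 + τ) * D (xu (N + 1)) xs - τ * D (xu N) (xu (N + 1))
          + ⟪G xs - G (xu (N + 1)), x (N + 1) - x N⟫
          - θ * ⟪G xs - G (xu N), x N - x (N - 1)⟫
          - θ * ⟪G (xu N) - G (xu (N + 1)), x N - x (N - 1)⟫ := by
        simp only [hD, inner_sub_right, inner_sub_left]
        linear_combination hrel (G (xu (N + 1))) - hrel (G xs)
      have hb : - (θ * ⟪G (xu N) - G (xu (N + 1)), x N - x (N - 1)⟫) ≤
          τ * D (xu N) (xu (N + 1)) + θ * (η / 2) * ‖x N - x (N - 1)‖ ^ 2 := by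
        have e1 := aux_amgm (c := θ) (A := τ * (1 / (2 * L))) (B := θ * (η / 2))
          (n := ‖G (xu N) - G (xu (N + 1))‖) (d := ‖x N - x (N - 1)‖) (by positivity)
          (by positivity) (by
            have : 4 * (τ * (1 / (2 * L))) * (θ * (η / 2)) = θ ^ 2 := by
              rw [h2, ← h1]; field_simp; norm_num; linarith
            rw [this])
        have e2 := mul_le_mul_of_nonneg_left (hDco (xu N) (xu (N + 1))) hτ.le
        have e3 := neg_le_of_abs_le
          (abs_real_inner_le_norm (G (xu N) - G (xu (N + 1))) (x N - x (N - 1)))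
        have e4 := mul_le_mul_of_nonneg_left e3 hθ.le
        linarith
      have hb' := mul_le_mul_of_nonneg_left hb hWpos.le
      have hid' := congrArg (fun z => W * z) hid
      have q1 : τ * (W / θ) = (1 + τ) * W := by
        field_simp; linarith
      have q2 : θ * (W / θ) = W := by field_simp
      rw [q1, q2]
      have q3 : W / θ * (η / 2 * ‖x (N + 1) - xs‖ ^ 2) =
        W * ((η / θ) / 2 * ‖x (N + 1) - xs‖ ^ 2) := by ring
      rw [q3]
      rw [norm_sub_rev xs] at hs
      simp only [mul_add, mul_sub] at hs hid' hb' ih ⊢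
      linarith
  have hN := claim N
  have hWpos : 0 < (1 / θ) ^ N := by positivity
  have hend : θ * ⟪G xs - G (xu N), x N - x (N - 1)⟫ ≤
      τ * D (xu N) xs + θ * (η / 2 * ‖x N - x (N - 1)‖ ^ 2) := by
    have e1 := aux_amgm (c := θ) (A := τ * (1 / (2 * L))) (B := θ * (η / 2))
      (n := ‖G (xu N) - G xs‖) (d := ‖x N - x (N - 1)‖) (by positivity)
      (by positivity) (by
        have : 4 * (τ * (1 / (2 * L))) * (θ * (η / 2)) = θ ^ 2 := by
          rw [h2, ← h1]; field_simp; norm_num; linarith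
        rw [this])
    have e2 := mul_le_mul_of_nonneg_left (hDco (xu N) xs) hτ.le
    have e3 := real_inner_le_norm (G xs - G (xu N)) (x N - x (N - 1))
    rw [norm_sub_rev (G xs)] at e3
    have e4 := mul_le_mul_of_nonneg_left e3 hθ.le
    linarith
  have hend' := mul_le_mul_of_nonneg_left hend hWpos.le
  have hD0 : D (x 0) xs ≤ L / 2 * ‖x 0 - xs‖ ^ 2 := by
    have := aux_descent hg hL xs (x 0)
    simp only [hD]; linarith
  have hD0' := mul_le_mul_of_nonneg_left hD0 hτ.le
  simp only [mul_add, mul_sub] at hN hend' ⊢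
  linarith

lemma aux_wsum {m : ℕ} {fi : Fin m → E → ℝ} (hfidiff : ∀ i, Differentiable ℝ (fi i))
    (p : Fin m → ℝ) (z : E) :
    HasGradientAt (fun z => ∑ i, p i * fi i z) (∑ i, p i • gradient (fi i) z) z := by
  rw [hasGradientAt_iff_hasFDerivAt, map_sum]
  refine HasFDerivAt.fun_sum fun i _ => ?_
  have := ((hfidiff i z).hasGradientAt.hasFDerivAt).const_mul (p i)
  simpa using this

lemma aux_wconv {m : ℕ} {fi : Fin m → E → ℝ} (hficv : ∀ i, ConvexOn ℝ Set.univ (fi i))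
    (p : Fin m → ℝ) (hp : ∀ i, 0 ≤ p i) :
    ConvexOn ℝ Set.univ (fun z => ∑ i, p i * fi i z) := by
  refine ⟨convex_univ, fun y _ x _ a b ha hb hab => ?_⟩
  simp only [smul_eq_mul]
  rw [Finset.mul_sum, Finset.mul_sum, ← Finset.sum_add_distrib]
  refine Finset.sum_le_sum fun i _ => ?_
  have := (hficv i).2 (Set.mem_univ y) (Set.mem_univ x) ha hb hab
  simp only [smul_eq_mul] at this
  have := mul_le_mul_of_nonneg_left this (hp i)
  linarith

lemma aux_opt {m : ℕ} {X : Set E} (hXcv : Convex ℝ X) {P : Set (Fin m → ℝ)}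
    {u : E → ℝ} (hu : ConvexOn ℝ Set.univ u) {ρ : (Fin m → ℝ) → ℝ}
    {fi : Fin m → E → ℝ} (hfidiff : ∀ i, Differentiable ℝ (fi i)) {Lf : ℝ}
    (hLf : ∀ p ∈ P, ∀ x y : E,
      ‖∑ i, p i • (gradient (fi i) x - gradient (fi i) y)‖ ≤ Lf * ‖x - y‖)
    {f : E → ℝ}
    (hf : ∀ xx, IsLUB ((fun p => (∑ i, p i * fi i xx) - ρ p) '' P) (f xx - u xx))
    {xs : E} (hxs : xs ∈ X) (hmin : IsMinOn f X xs) {z : E} (hz : z ∈ X) {c : ℝ}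
    (hcb : ∀ p ∈ P, (∑ i, p i * fi i xs) + ⟪∑ i, p i • gradient (fi i) xs, z - xs⟫ - ρ p + u z ≤ c) :
    f xs ≤ c := by
  have key : f xs - c ≤ 0 := by
    apply aux_limit (B := Lf / 2 * ‖z - xs‖ ^ 2)
    intro l hl0 hl1
    have hmem : (1 - l) • xs + l • z ∈ X := hXcv hxs hz (by linarith) hl0.le (by ring)
    have e : (1 - l) • xs + l • z = xs + l • (z - xs) := by module
    have h1 := hmin hmem
    simp only [Set.mem_ofPred_eq] at h1
    have h2 := hu.2 (Set.mem_univ xs) (Set.mem_univ z) (by linarith : 0 ≤ 1 - l) hl0.le (by ring)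
    simp only [smul_eq_mul] at h2
    rw [e] at h1 h2
    have h3 : f (xs + l • (z - xs)) - u (xs + l • (z - xs)) ≤
        (1 - l) * (f xs - u xs) + l * (c - u z) + l * (Lf / 2 * ‖z - xs‖ ^ 2 * l) := by
      refine (hf _).2 ?_
      rintro _ ⟨p, hp, rfl⟩
      have hL : ∀ x y : E, ‖(∑ i, p i • gradient (fi i) x) - ∑ i, p i • gradient (fi i) y‖
          ≤ Lf * ‖x - y‖ := by
        intro x y
        have := hLf p hp x y
        simpa only [smul_sub, Finset.sum_sub_distrib] using this
      have hd := aux_descent (aux_wsum hfidiff p) hL xs (xs + l • (z - xs))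
      rw [add_sub_cancel_left, inner_smul_right, norm_smul, mul_pow, Real.norm_eq_abs,
        sq_abs] at hd
      have hc1 := hcb p hp
      have hc2 := (hf xs).1 ⟨p, hp, rfl⟩
      simp only at hc2 ⊢
      have hc1' := mul_le_mul_of_nonneg_left hc1 hl0.le
      have hc2' := mul_le_mul_of_nonneg_left hc2 (by linarith : 0 ≤ 1 - l)
      linarith
    have h4 : l * (f xs - c) ≤ l * (Lf / 2 * ‖z - xs‖ ^ 2 * l) := by linarith
    exact le_of_mul_le_mul_left h4 hl0
  linarith

lemma aux_Mbound {m : ℕ} {NU : (Fin m → ℝ) → ℝ}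
    (hNUnn : ∀ p, 0 ≤ NU p) (hNU0 : ∀ p, NU p = 0 ↔ p = 0)
    (hNUhom : ∀ (c : ℝ) p, NU (c • p) = |c| * NU p) (v : Fin m → E) {M : ℝ}
    (hM : IsLUB {r : ℝ | ∃ (p : Fin m → ℝ) (yy : E),
      NU p ≤ 1 ∧ ‖yy‖ ≤ 1 ∧ r = ∑ i, p i * ⟪v i, yy⟫} M) (p : Fin m → ℝ) (z : E) :
    ∑ i, p i * ⟪v i, z⟫ ≤ M * NU p * ‖z‖ := by
  by_cases hp : p = 0
  · have := (hNU0 p).2 hp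
    rw [this, hp]; simp
  by_cases hz : z = 0
  · simp [hz]
  have hN : 0 < NU p := lt_of_le_of_ne (hNUnn p) (fun h => hp ((hNU0 p).1 h.symm))
  have hzn : 0 < ‖z‖ := norm_pos_iff.2 hz
  have h := hM.1 ⟨(NU p)⁻¹ • p, ‖z‖⁻¹ • z, by
    rw [hNUhom, abs_of_pos (by positivity)]; field_simp; exact le_rfl, by
    rw [norm_smul, norm_inv, norm_norm]; field_simp; exact le_rfl, rfl⟩
  have e : ∑ i, ((NU p)⁻¹ • p) i * ⟪v i, ‖z‖⁻¹ • z⟫ =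
      (NU p)⁻¹ * ‖z‖⁻¹ * ∑ i, p i * ⟪v i, z⟫ := by
    rw [Finset.mul_sum]
    refine Finset.sum_congr rfl fun i _ => ?_
    rw [inner_smul_right, Pi.smul_apply, smul_eq_mul]; ring
  rw [e] at h
  have h2 := mul_le_mul_of_nonneg_left h (by positivity : 0 ≤ NU p * ‖z‖)
  have e2 : NU p * ‖z‖ * ((NU p)⁻¹ * ‖z‖⁻¹ * ∑ i, p i * ⟪v i, z⟫) = ∑ i, p i * ⟪v i, z⟫ := by
    field_simp
  linarith

end

lemma aux_NU {m : ℕ} {NU : (Fin m → ℝ) → ℝ}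
    (hNUnn : ∀ p, 0 ≤ NU p) (hNU0 : ∀ p, NU p = 0 ↔ p = 0)
    (hNUhom : ∀ (c : ℝ) p, NU (c • p) = |c| * NU p)
    (hNUadd : ∀ p p', NU (p + p') ≤ NU p + NU p') :
    ∃ C : ℝ, 0 ≤ C ∧ ∀ p, NU p ≤ 1 → ∀ i, |p i| ≤ C := by
  have hcv : ConvexOn ℝ Set.univ NU := by
    refine ⟨convex_univ, fun y _ x _ a b ha hb hab => ?_⟩
    have := hNUadd (a • y) (b • x)
    rw [hNUhom, hNUhom, abs_of_nonneg ha, abs_of_nonneg hb] at this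
    exact this
  have hcont : Continuous NU := by
    have := hcv.continuousOn_interior
    rw [interior_univ] at this
    exact continuousOn_univ.1 this
  rcases (Metric.sphere (0 : Fin m → ℝ) 1).eq_empty_or_nonempty with he | hne
  · refine ⟨0, le_rfl, fun p _ i => ?_⟩
    by_contra hcon
    have hp : p ≠ 0 := by
      rintro rfl; simp at hcon
    have : ‖p‖⁻¹ • p ∈ Metric.sphere (0 : Fin m → ℝ) 1 := by
      have : 0 < ‖p‖ := norm_pos_iff.2 hp
      rw [mem_sphere_zero_iff_norm, norm_smul, norm_inv, norm_norm]; field_simp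
    rw [he] at this; exact this
  · obtain ⟨q, hq, hmin⟩ := (isCompact_sphere (0 : Fin m → ℝ) 1).exists_isMinOn hne
      hcont.continuousOn
    have hq0 : q ≠ 0 := by
      rintro rfl; simp at hq
    have hNq : 0 < NU q := lt_of_le_of_ne (hNUnn q) (fun h => hq0 ((hNU0 q).1 h.symm))
    refine ⟨(NU q)⁻¹, by positivity, fun p hp i => ?_⟩
    by_cases hp0 : p = 0
    · rw [hp0]; simpa using hNq.le
    have hpn : 0 < ‖p‖ := norm_pos_iff.2 hp0
    have hmem : ‖p‖⁻¹ • p ∈ Metric.sphere (0 : Fin m → ℝ) 1 := by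
      rw [mem_sphere_zero_iff_norm, norm_smul, norm_inv, norm_norm]; field_simp
    have h1 := hmin hmem
    simp only [Set.mem_ofPred_eq] at h1
    rw [hNUhom, abs_of_pos (by positivity), le_inv_mul_iff₀ hpn] at h1
    have h2 : |p i| ≤ ‖p‖ := norm_le_pi_norm p i
    rw [← one_div, le_div_iff₀ hNq]
    nlinarith

set_option maxHeartbeats 4000000 in
/-- **DRAO-S linear rate for smooth strongly convex problems** (Theorem 4.2). -/
theorem DRAOS_smooth_strongly_convex_rate
    (n m : ℕ) (hm : 1 ≤ m)
    (X : Set (EuclideanSpace ℝ (Fin n)))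
    (hXne : X.Nonempty) (hXcl : IsClosed X) (hXcv : Convex ℝ X)
    (P : Set (Fin m → ℝ))
    (hPne : P.Nonempty) (hPcl : IsClosed P) (hPcv : Convex ℝ P)
    (hPsub : ∀ p ∈ P, (∑ i, p i) = 1 ∧ ∀ i, 0 ≤ p i)
    -- `u` is `α`-strongly convex with `α > 0`
    (α : ℝ) (hαpos : 0 < α)
    (u : EuclideanSpace ℝ (Fin n) → ℝ) (hu : StrongConvexOn Set.univ α u)
    (ρstar : (Fin m → ℝ) → ℝ)
    (hρcv : ConvexOn ℝ Set.univ ρstar) (hρlsc : LowerSemicontinuous ρstar)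
    -- smooth setting
    (fi : Fin m → EuclideanSpace ℝ (Fin n) → ℝ)
    (hficv : ∀ i, ConvexOn ℝ Set.univ (fi i))
    (hfidiff : ∀ i, Differentiable ℝ (fi i))
    (Li : Fin m → ℝ)
    (hLi : ∀ i, ∀ x y : EuclideanSpace ℝ (Fin n),
      ‖gradient (fi i) x - gradient (fi i) y‖ ≤ Li i * ‖x - y‖)
    (Lf : ℝ) (hLfpos : 0 < Lf)
    (hLf : ∀ p ∈ P, ∀ x y : EuclideanSpace ℝ (Fin n),
      ‖∑ i, p i • (gradient (fi i) x - gradient (fi i) y)‖ ≤ Lf * ‖x - y‖)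
    -- the objective `f` and its minimizer `x*` over `X`
    (f : EuclideanSpace ℝ (Fin n) → ℝ)
    (hf : ∀ xx, IsLUB ((fun p => (∑ i, p i * fi i xx) - ρstar p) '' P) (f xx - u xx))
    (xstar : EuclideanSpace ℝ (Fin n)) (hxstarX : xstar ∈ X) (hxstar : IsMinOn f X xstar)
    -- `‖·‖_U` norm, `U` Bregman divergence of `ω`, 1-strongly convex w.r.t. `‖·‖_U`
    (NU : (Fin m → ℝ) → ℝ)
    (hNUnn : ∀ p, 0 ≤ NU p) (hNU0 : ∀ p, NU p = 0 ↔ p = 0)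
    (hNUhom : ∀ (c : ℝ) p, NU (c • p) = |c| * NU p)
    (hNUadd : ∀ p p', NU (p + p') ≤ NU p + NU p')
    (U : (Fin m → ℝ) → (Fin m → ℝ) → ℝ)
    (ω : (Fin m → ℝ) → ℝ) (hωdiff : Differentiable ℝ ω) (hωcv : ConvexOn ℝ Set.univ ω)
    (hUdef : ∀ p p', U p p' = ω p - ω p' - (fderiv ℝ ω p') (p - p'))
    (hUstrong : ∀ p p', (1 / 2) * (NU (p - p')) ^ 2 ≤ U p p')
    (DP Δ : ℝ) (hDPnn : 0 ≤ DP) (hΔpos : 0 < Δ)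
    (hDP : ∀ p ∈ P, ∀ p' ∈ P, 2 * U p p' ≤ DP ^ 2)
    -- condition number and constant outer stepsizes
    (κ θ τ η : ℝ)
    (hκ : κ = Lf / α)
    (hθ : θ = (Real.sqrt (8 * κ + 1) - 1) / (Real.sqrt (8 * κ + 1) + 1))
    (hτ : τ = (Real.sqrt (8 * κ + 1) - 1) / 2)
    (hη : η = α * (Real.sqrt (8 * κ + 1) - 1) / 4)
    -- outer DRAO loop (convention `x⁻¹ = x⁰` via `ℕ`-subtraction), `w_t = (1/θ)^{t−1}`
    (x : ℕ → EuclideanSpace ℝ (Fin n)) (hx0 : x 0 ∈ X)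
    (xund : ℕ → EuclideanSpace ℝ (Fin n)) (hxund0 : xund 0 = x 0)
    (hxund : ∀ t : ℕ, 1 ≤ t →
      xund t = (1 + τ)⁻¹ •
        ((x (t-1) + θ • (x (t-1) - x (t-2))) + τ • xund (t-1)))
    (v : ℕ → Fin m → EuclideanSpace ℝ (Fin n))
    (hv : ∀ t, 1 ≤ t → ∀ i, v t i = gradient (fi i) (xund t))
    (hv0 : ∀ i, v 0 i = v 1 i)
    -- `M_t = ‖v^t‖_{2,U*}`, `S_t = ⌈√(2 w_t Δ) M_t⌉ ≥ 1`
    (M : ℕ → ℝ)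
    (hM : ∀ t, 1 ≤ t → IsLUB {r : ℝ | ∃ (p : Fin m → ℝ) (yy : EuclideanSpace ℝ (Fin n)),
      NU p ≤ 1 ∧ ‖yy‖ ≤ 1 ∧ r = ∑ i, p i * ⟪v t i, yy⟫} (M t))
    (S : ℕ → ℕ)
    (hS : ∀ t, 1 ≤ t → S t = ⌈Real.sqrt (2 * (1 / θ) ^ (t-1) * Δ) * M t⌉₊)
    (hSpos : ∀ t, 1 ≤ t → 1 ≤ S t)
    -- inner SPS loops with `q_s^t = s`, `β_s^t = α(s−1)/4`,
    -- `γ_s^t = 2S_t(S_t+1)/(w_t α s Δ)`, `δ_s^t = (s−1)/s`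
    (y : ℕ → ℕ → EuclideanSpace ℝ (Fin n))
    (pq : ℕ → ℕ → Fin m → ℝ) (pm : ℕ → Fin m → ℝ)
    (hy01 : y 1 0 = x 0) (hy0t : ∀ t, 2 ≤ t → y t 0 = y (t-1) (S (t-1)))
    (hpq01 : pq 1 0 ∈ P) (hpm1 : pm 1 = pq 1 0)
    (hpq0t : ∀ t, 2 ≤ t → pq t 0 = pq (t-1) (S (t-1)))
    (hpmt : ∀ t, 2 ≤ t → pm t = pq (t-1) (S (t-1) - 1))
    (vtil : ℕ → ℕ → EuclideanSpace ℝ (Fin n))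
    (hvtil1 : ∀ t, 1 ≤ t → vtil t 1 =
      (∑ i, pq t 0 i • v t i)
        + (((1 : ℝ) - 1) / 1) • ∑ i, (pq t 0 i - pm t i) • v (t-1) i)
    (hvtils : ∀ t, 1 ≤ t → ∀ s : ℕ, 2 ≤ s → vtil t s =
      (∑ i, pq t (s-1) i • v t i)
        + (((s : ℝ) - 1) / (s : ℝ)) • ∑ i, (pq t (s-1) i - pq t (s-2) i) • v t i)
    (hyupd : ∀ t, 1 ≤ t → ∀ s : ℕ, 1 ≤ s → s ≤ S t → y t s ∈ X ∧
      IsMinOn (fun yy => ⟪yy, vtil t s⟫ + u yy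
        + (α * ((s : ℝ) - 1) / 4) / 2 * ‖yy - y t (s-1)‖ ^ 2
        + η / 2 * ‖yy - x (t-1)‖ ^ 2) X (y t s))
    (hpqupd : ∀ t, 1 ≤ t → ∀ s : ℕ, 1 ≤ s → s ≤ S t → pq t s ∈ P ∧
      IsMaxOn (fun p' =>
        (∑ i, p' i * (fi i (xund t) + ⟪v t i, y t s - xund t⟫))
        - ρstar p'
        - (2 * (S t : ℝ) * ((S t : ℝ) + 1) / ((1 / θ) ^ (t-1) * α * (s : ℝ) * Δ)) *
            U p' (pq t (s-1))) P (pq t s))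
    -- phase output `x^t` (weighted average with weights `q_s^t = s`)
    (hxdef : ∀ t, 1 ≤ t → x t =
      (∑ s ∈ Finset.Icc 1 (S t), (s : ℝ))⁻¹ •
        ∑ s ∈ Finset.Icc 1 (S t), (s : ℝ) • y t s) :
    (∀ N : ℕ, 1 ≤ N →
      ‖x N - xstar‖ ^ 2 ≤
        θ ^ N * ((1 + 2 * κ) * ‖x 0 - xstar‖ ^ 2 + 4 * DP ^ 2 / (α * η * Δ)))
    ∧ (∃ Mtil : ℝ, ∀ t : ℕ, 1 ≤ t → M t ≤ Mtil) := by
  -- constants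
  have hκpos : 0 < κ := by rw [hκ]; positivity
  set r : ℝ := Real.sqrt (8 * κ + 1) with hr
  have hr2 : r ^ 2 = 8 * κ + 1 := Real.sq_sqrt (by positivity)
  have hr0 : 0 ≤ r := Real.sqrt_nonneg _
  have hr1 : 1 < r := by nlinarith
  have hτpos : 0 < τ := by rw [hτ]; linarith
  have hrτ : r = 2 * τ + 1 := by rw [hτ]; ring
  have hητ : η = α * τ / 2 := by rw [hη, hrτ]; ring
  have hηpos : 0 < η := by rw [hητ]; positivity
  have hθτ : θ * (1 + τ) = τ := by
    rw [hθ, hrτ]; field_simp; ring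
  have hθpos : 0 < θ := by
    by_contra hcon
    nlinarith
  have hθ1 : θ < 1 := by nlinarith
  have hκτ : 2 * κ = τ * (1 + τ) := by rw [hrτ] at hr2; linarith
  have hLη : Lf = η * (1 + τ) := by
    have : Lf = κ * α := by rw [hκ]; field_simp
    rw [this, hητ]; linear_combination (α / 2) * hκτ
  have hηα : η + α / 2 = η / θ := by
    rw [eq_div_iff hθpos.ne', hητ]; linear_combination (α / 2) * hθτ
  have huc : ConvexOn ℝ Set.univ u := UniformConvexOn.convexOn hu (fun r => by
        have : 0 ≤ α / 2 * r ^ 2 := by positivity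
        simpa using this)
  have hgrad : ∀ i z, HasGradientAt (fi i) (gradient (fi i) z) z :=
    fun i z => (hfidiff i z).hasGradientAt
  -- iterates stay in `X`
  have hxX : ∀ t, x t ∈ X := by
    intro t
    rcases Nat.eq_zero_or_pos t with rfl | ht
    · exact hx0
    · rw [hxdef t ht]
      have hpos : 0 < ∑ s ∈ Finset.Icc 1 (S t), (s : ℝ) := by
        refine Finset.sum_pos (fun s hs => ?_) ⟨1, by simp [hSpos t ht]⟩
        exact_mod_cast (Finset.mem_Icc.1 hs).1
      have := hXcv.centerMass_mem (t := Finset.Icc 1 (S t)) (w := fun s : ℕ => (s:ℝ)) (z := y t)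
        (fun s _ => Nat.cast_nonneg s) hpos
        (fun s hs => (hyupd t ht s (Finset.mem_Icc.1 hs).1 (Finset.mem_Icc.1 hs).2).1)
      simpa [Finset.centerMass] using this
  -- one phase
  have hphase : ∀ p ∈ P, ∀ k : ℕ,
      (∑ i, p i * (fi i (xund (k+1)) + ⟪v (k+1) i, x (k+1) - xund (k+1)⟫)) - ρstar p
      + u (x (k+1)) - f xstar + η / 2 * ‖x (k+1) - x k‖ ^ 2
      - η / 2 * ‖xstar - x k‖ ^ 2 + (η + α / 2) / 2 * ‖x (k+1) - xstar‖ ^ 2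
      ≤ 4 / ((1 / θ) ^ k * α * Δ) * (U p (pq (k+1) 0) - U p (pq (k+1) (S (k+1)))) := by
    intro p hp k
    have ht : 1 ≤ k + 1 := by omega
    have hwpos : 0 < (1 / θ) ^ k := by positivity
    refine aux_inner hXcv hPcv hαpos hu hρcv hωdiff hUdef ((hNU0 0).2 rfl) hUstrong
      (fun i => fi i (xund (k+1))) (v (k+1)) (xund (k+1)) (x k) hηpos.le
      (M := M (k+1)) (aux_Mbound hNUnn hNU0 hNUhom (v (k+1)) (hM (k+1) ht))
      (hSpos (k+1) ht) hwpos hΔpos ?_ (y (k+1)) (pq (k+1)) (vtil (k+1)) ?_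
      (hyupd (k+1) ht) (hpqupd (k+1) ht) hxstarX hp ?_ (hxdef (k+1) ht)
    · have h1 : Real.sqrt (2 * (1 / θ) ^ k * Δ) * M (k+1) ≤ S (k+1) := by
        rw [hS (k+1) ht]; exact Nat.le_ceil _
      have hM0 : 0 ≤ M (k+1) := (hM (k+1) ht).1
        ⟨0, 0, by rw [(hNU0 0).2 rfl]; exact zero_le_one, by simp, by simp⟩
      have h2 := pow_le_pow_left₀ (by positivity) h1 2
      rwa [mul_pow, Real.sq_sqrt (by positivity)] at h2
    · intro j
      rcases Nat.eq_zero_or_pos j with rfl | hj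
      · have := hvtil1 (k+1) ht
        simpa using this
      · have := hvtils (k+1) ht (j+1) (by omega)
        rw [this]
        have e : j + 1 - 2 = j - 1 := by omega
        rw [e]
        simp
    · intro p' hp'
      have h1 := (hf xstar).1 ⟨p', hp', rfl⟩
      simp only at h1
      have h2 : ∑ i, p' i * (fi i (xund (k+1)) + ⟪v (k+1) i, xstar - xund (k+1)⟫) ≤
          ∑ i, p' i * fi i xstar := by
        refine Finset.sum_le_sum fun i _ => mul_le_mul_of_nonneg_left ?_ ((hPsub p' hp').2 i)
        rw [hv (k+1) ht]
        exact aux_convex_lower (hgrad i) (hficv i) _ _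
      linarith
  -- momentum relation
  have hxu : ∀ k, (1 + τ) • xund (k + 1) = x k + θ • (x k - x (k - 1)) + τ • xund k := by
    intro k
    have h := hxund (k+1) (by omega)
    have e : k + 1 - 2 = k - 1 := by omega
    rw [e, Nat.add_sub_cancel] at h
    rw [h, smul_inv_smul₀ (by positivity)]
  have hsumin : ∀ (p : Fin m → ℝ) (w : Fin m → EuclideanSpace ℝ (Fin n)) z,
      ⟪∑ i, p i • w i, z⟫ = ∑ i, p i * ⟪w i, z⟫ := by
    intro p w z
    rw [sum_inner]
    exact Finset.sum_congr rfl fun i _ => by rw [inner_smul_left]; simp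
  -- outer sum
  have houter : ∀ p ∈ P, ∀ N : ℕ,
      (∑ k ∈ Finset.range N, (1 / θ) ^ k * ((∑ i, p i * fi i xstar)
        + ⟪∑ i, p i • gradient (fi i) xstar, x (k + 1) - xstar⟫
        + (u (x (k+1)) - ρstar p - f xstar)))
      + (1 / θ) ^ N * (η / 2 * ‖x N - xstar‖ ^ 2) ≤ η / 2 * ‖x 0 - xstar‖ ^ 2
        + τ * (Lf / 2 * ‖x 0 - xstar‖ ^ 2) + 2 * DP ^ 2 / (α * Δ) := by
    intro p hp N
    have hL : ∀ x y : EuclideanSpace ℝ (Fin n),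
        ‖(∑ i, p i • gradient (fi i) x) - ∑ i, p i • gradient (fi i) y‖
          ≤ Lf * ‖x - y‖ := by
      intro x y
      have := hLf p hp x y
      simpa only [smul_sub, Finset.sum_sub_distrib] using this
    have h := aux_outer (aux_wsum hfidiff p) (aux_wconv hficv p (hPsub p hp).2) hLfpos hL
      hθpos hτpos hηpos hθτ hLη x xund xstar hxund0 hxu
      (fun k => u (x (k+1)) - ρstar p - f xstar) (fun k => U p (pq (k+1) 0))
      (K := 4 / (α * Δ)) (by
        intro k
        have h1 := hphase p hp k
        have e0 : pq (k+1+1) 0 = pq (k+1) (S (k+1)) := hpq0t (k+1+1) (by omega)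
        rw [← e0] at h1
        have e1 : ∑ i, p i * (fi i (xund (k+1)) + ⟪v (k+1) i, x (k+1) - xund (k+1)⟫) =
            (∑ i, p i * fi i (xund (k+1))) +
            ⟪∑ i, p i • gradient (fi i) (xund (k+1)), x (k+1) - xund (k+1)⟫ := by
          rw [hsumin, ← Finset.sum_add_distrib]
          exact Finset.sum_congr rfl fun i _ => by rw [hv (k+1) (by omega)]; ring
        have e2 : 4 / ((1 / θ) ^ k * α * Δ) = 4 / (α * Δ) / (1 / θ) ^ k := by
          rw [div_div]; ring_nf
        rw [e1, hηα, e2] at h1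
        linarith) N
    have hU0 : U p (pq (0+1) 0) ≤ DP ^ 2 / 2 := by
      have := hDP p hp _ hpq01
      rw [zero_add]; linarith
    have hUN : 0 ≤ U p (pq (N+1) 0) := le_trans (by positivity) (hUstrong _ _)
    have hK : 0 < 4 / (α * Δ) := by positivity
    have e1 := mul_le_mul_of_nonneg_left hU0 hK.le
    have e2 := mul_nonneg hK.le hUN
    have e3 : 4 / (α * Δ) * (DP ^ 2 / 2) = 2 * DP ^ 2 / (α * Δ) := by ring
    linarith
  set R : ℝ := (1 + 2 * κ) * ‖x 0 - xstar‖ ^ 2 + 4 * DP ^ 2 / (α * η * Δ) with hR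
  have hrate : ∀ N : ℕ, 1 ≤ N → ‖x N - xstar‖ ^ 2 ≤ θ ^ N * R := by
    intro N hN
    set W : ℝ := ∑ k ∈ Finset.range N, (1 / θ) ^ k with hW
    have hWpos : 0 < W := Finset.sum_pos (fun k _ => by positivity) ⟨0, by simp; omega⟩
    set z := W⁻¹ • ∑ k ∈ Finset.range N, (1 / θ) ^ k • x (k+1) with hz
    have hzX : z ∈ X := by
      have := hXcv.centerMass_mem (t := Finset.range N) (w := fun k : ℕ => (1 / θ) ^ k)
        (z := fun k => x (k+1)) (fun k _ => by positivity) hWpos (fun k _ => hxX _)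
      simpa [Finset.centerMass, hz, hW] using this
    set T := (1 / θ) ^ N * (η / 2 * ‖x N - xstar‖ ^ 2) with hT
    set Q := η / 2 * ‖x 0 - xstar‖ ^ 2
        + τ * (Lf / 2 * ‖x 0 - xstar‖ ^ 2) + 2 * DP ^ 2 / (α * Δ) with hQ
    have hopt : f xstar ≤ f xstar + (Q - T) / W := by
      refine aux_opt hXcv huc hfidiff hLf hf hxstarX hxstar hzX ?_
      intro p hp
      have h := houter p hp N
      set Ψ : EuclideanSpace ℝ (Fin n) → ℝ := fun z => (∑ i, p i *
        (fi i xstar + ⟪gradient (fi i) xstar, z - xstar⟫)) + u z with hΨ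
      have hΨc : ConvexOn ℝ Set.univ Ψ :=
        (aux_convex_aff p (fun i => fi i xstar) (fun i => gradient (fi i) xstar) xstar).add huc
      have hΨe : ∀ z, Ψ z = (∑ i, p i * fi i xstar)
          + ⟪∑ i, p i • gradient (fi i) xstar, z - xstar⟫ + u z := by
        intro z
        simp only [hΨ]
        rw [hsumin, ← Finset.sum_add_distrib]
        congr 1
        exact Finset.sum_congr rfl fun i _ => by ring
      have hJ : W * Ψ z ≤ ∑ k ∈ Finset.range N, (1 / θ) ^ k * Ψ (x (k+1)) := by
        have := hΨc.map_centerMass_le (t := Finset.range N) (w := fun k : ℕ => (1 / θ) ^ k)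
          (p := fun k => x (k+1)) (fun k _ => by positivity) hWpos (fun _ _ => Set.mem_univ _)
        rw [Finset.centerMass, Finset.centerMass, ← hW, ← hz, smul_eq_mul] at this
        have := mul_le_mul_of_nonneg_left this hWpos.le
        rw [mul_inv_cancel_left₀ hWpos.ne'] at this
        simpa only [smul_eq_mul, Function.comp] using this
      have hsum : ∑ k ∈ Finset.range N, (1 / θ) ^ k * ((∑ i, p i * fi i xstar)
          + ⟪∑ i, p i • gradient (fi i) xstar, x (k + 1) - xstar⟫
          + (u (x (k+1)) - ρstar p - f xstar)) =
          (∑ k ∈ Finset.range N, (1 / θ) ^ k * Ψ (x (k+1))) - W * (ρstar p + f xstar) := by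
        rw [hW, Finset.sum_mul, ← Finset.sum_sub_distrib]
        refine Finset.sum_congr rfl fun k _ => ?_
        rw [hΨe]; ring
      rw [hsum] at h
      have h2 : W * (Ψ z - ρstar p - f xstar) ≤ Q - T := by linarith
      have h3 : Ψ z - ρstar p - f xstar ≤ (Q - T) / W := by
        rw [le_div_iff₀ hWpos]; linarith
      rw [hΨe] at h3
      linarith
    have hTQ : T ≤ Q := by
      have h1 : 0 ≤ (Q - T) / W := by linarith
      have h2 := mul_nonneg h1 hWpos.le
      rw [div_mul_cancel₀ _ hWpos.ne'] at h2
      linarith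
    have hQR : Q = η / 2 * R := by
      rw [hQ, hR, hκτ, hLη]; field_simp; ring
    have hθN : 0 < θ ^ N := by positivity
    have hT2 : θ ^ N * T = η / 2 * ‖x N - xstar‖ ^ 2 := by
      rw [hT, one_div, inv_pow]; field_simp
    have h1 := mul_le_mul_of_nonneg_left hTQ hθN.le
    rw [hT2, hQR] at h1
    have h2 : η / 2 * ‖x N - xstar‖ ^ 2 ≤ η / 2 * (θ ^ N * R) := by linarith
    exact le_of_mul_le_mul_left h2 (by positivity)
  refine ⟨hrate, ?_⟩
  -- boundedness
  have hRnn : 0 ≤ R := by positivity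
  have hxb : ∀ t, ‖x t - xstar‖ ≤ Real.sqrt R := by
    intro t
    apply Real.le_sqrt_of_sq_le
    rcases Nat.eq_zero_or_pos t with rfl | ht
    · have h1 : 0 ≤ 4 * DP ^ 2 / (α * η * Δ) := by positivity
      have h2 : 0 ≤ 2 * κ * ‖x 0 - xstar‖ ^ 2 := by positivity
      rw [hR]; linarith
    · refine (hrate t ht).trans ?_
      exact mul_le_of_le_one_left hRnn (pow_le_one₀ hθpos.le hθ1.le)
  set q := Real.sqrt R with hq
  have hq0 : 0 ≤ q := Real.sqrt_nonneg _
  have hub : ∀ t, ‖xund t - xstar‖ ≤ 3 * q := by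
    intro t
    induction t with
    | zero => rw [hxund0]; linarith [hxb 0]
    | succ k ih =>
      have e : (1 + τ) • (xund (k+1) - xstar) = (x k - xstar)
          + θ • ((x k - xstar) - (x (k-1) - xstar)) + τ • (xund k - xstar) := by
        rw [smul_sub, hxu k]; module
      have h1 : (1 + τ) * ‖xund (k+1) - xstar‖ ≤ q + θ * (q + q) + τ * (3 * q) := by
        calc (1 + τ) * ‖xund (k+1) - xstar‖ = ‖(1 + τ) • (xund (k+1) - xstar)‖ := by
              rw [norm_smul, Real.norm_eq_abs, abs_of_pos (by positivity)]
          _ ≤ ‖x k - xstar‖ + θ * (‖x k - xstar‖ + ‖x (k-1) - xstar‖)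
              + τ * ‖xund k - xstar‖ := by
              rw [e]
              refine (norm_add_le _ _).trans (add_le_add ((norm_add_le _ _).trans
                (add_le_add le_rfl ?_)) ?_)
              · rw [norm_smul, Real.norm_eq_abs, abs_of_pos hθpos]
                exact mul_le_mul_of_nonneg_left (norm_sub_le _ _) hθpos.le
              · rw [norm_smul, Real.norm_eq_abs, abs_of_pos hτpos]
          _ ≤ _ := by
              gcongr
              · exact hxb k
              · exact hxb k
              · exact hxb (k-1)
      have h2 : (1 + τ) * ‖xund (k+1) - xstar‖ ≤ (1 + τ) * (3 * q) := by
        have := mul_le_mul_of_nonneg_right hθ1.le hq0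
        linarith
      exact le_of_mul_le_mul_left h2 (by positivity)
  obtain ⟨C, hC0, hC⟩ := aux_NU hNUnn hNU0 hNUhom hNUadd
  refine ⟨∑ i, C * (‖gradient (fi i) xstar‖ + |Li i| * (3 * q)), fun t ht => (hM t ht).2 ?_⟩
  rintro _ ⟨p, yy, hp, hyy, rfl⟩
  refine Finset.sum_le_sum fun i _ => ?_
  have h1 : ‖v t i‖ ≤ ‖gradient (fi i) xstar‖ + |Li i| * (3 * q) := by
    rw [hv t ht]
    have h2 : ‖gradient (fi i) (xund t) - gradient (fi i) xstar‖ ≤ |Li i| * (3 * q) := by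
      refine (hLi i _ _).trans ?_
      calc Li i * ‖xund t - xstar‖ ≤ |Li i| * ‖xund t - xstar‖ := by
            gcongr; exact le_abs_self _
        _ ≤ _ := by gcongr; exact hub t
    have h3 := norm_le_norm_add_norm_sub' (gradient (fi i) (xund t)) (gradient (fi i) xstar)
    linarith
  calc p i * ⟪v t i, yy⟫ ≤ |p i| * |⟪v t i, yy⟫| := by
        rw [← abs_mul]; exact le_abs_self _
    _ ≤ C * (‖v t i‖ * 1) := by
        gcongr
        · exact hC p hp i
        · exact (abs_real_inner_le_norm _ _).trans (by gcongr)
    _ ≤ _ := by rw [mul_one]; gcongr
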